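/- Let q ≥ 3 be an integer. Then ∑_{χ ≠ χ₀ (mod q)} |L(1,χ)|² = φ(q) ∑_{a=1, (a,q)=1}^{q} (1/a + (1/q)∑_{n≥0} a_n (a/q)ⁿ)² − (φ(q)²/q²)(log q + ∑_{p|q} (log p)/(p−1) + γ)², where a₀ = γ, a_n = (−1)ⁿ ζ(n+1) for n ≥ 1, γ is Euler's constant, φ is Euler's totient, and the sum over χ is over non-principal Dirichlet characters modulo q. -/

import Mathlib

open HurwitzZeta
open scoped Classical

/-- The coefficients `a₀ = γ`, `a_n = (−1)ⁿ ζ(n+1)` for `n ≥ 1`. -/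
noncomputable def aSeq : ℕ → ℂ
  | 0 => (Real.eulerMascheroniConstant : ℂ)
  | (n + 1) => (-1 : ℂ) ^ (n + 1) * riemannZeta ((n : ℂ) + 2)

open Filter Topology

noncomputable def psiE (x : ℝ) : ℝ := 1 / x + ∑' n : ℕ, (1 / (n + 1 + x) - 1 / ((n : ℝ) + 1))

lemma psiE_bound {x : ℝ} (hx0 : 0 < x) (hx1 : x < 1) {s : ℝ} (hs : 1 ≤ s) (hs2 : s ≤ 2) (n : ℕ) :
    ‖1 / (n + 1 + x) ^ s - 1 / ((n : ℝ) + 1) ^ s‖ ≤ 2 * (1 / ((n : ℝ) + 1) ^ 2) := by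
  have hn : (0 : ℝ) ≤ n := n.cast_nonneg
  set m : ℝ := (n : ℝ) + 1 with hm
  have hm1 : 1 ≤ m := by linarith
  have hm0 : 0 < m := by linarith
  have h1 : m ^ s ≤ (m + x) ^ s := Real.rpow_le_rpow hm0.le (by linarith) (by linarith)
  have hp : 0 < m ^ s := by positivity
  have h2 : 1 / (m + x) ^ s ≤ 1 / m ^ s := one_div_le_one_div_of_le hp h1
  rw [Real.norm_eq_abs, abs_sub_comm, abs_of_nonneg (by linarith)]
  have hsplit : (m + x) ^ s = m ^ s * (1 + x / m) ^ s := by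
    rw [← Real.mul_rpow hm0.le (by positivity)]; congr 1; field_simp
  have ht : (1 + x / m) ^ s ≤ (1 + x / m) ^ (2 : ℝ) :=
    Real.rpow_le_rpow_of_exponent_le (by simp; positivity) hs2
  rw [Real.rpow_two] at ht
  set t := x / m with htd
  have ht0 : 0 < t := by positivity
  have hq : 0 < (1 + t) ^ s := by positivity
  have h3 : 1 - 2 * t ≤ 1 / (1 + t) ^ s := by
    calc 1 - 2 * t ≤ 1 / (1 + t) ^ 2 := by
          rw [le_div_iff₀ (by positivity)]
          nlinarith [mul_pos ht0 ht0, mul_pos ht0 (mul_pos ht0 ht0)]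
      _ ≤ _ := one_div_le_one_div_of_le hq ht
  have h4 : m ≤ m ^ s := by
    simpa using Real.rpow_le_rpow_of_exponent_le hm1 hs
  have h5 : 1 / m ^ s ≤ 1 / m := one_div_le_one_div_of_le hm0 h4
  have htm : t ≤ 1 / m := by rw [htd]; gcongr
  calc 1 / m ^ s - 1 / (m + x) ^ s = 1 / m ^ s * (1 - 1 / (1 + t) ^ s) := by
        rw [hsplit]; field_simp
    _ ≤ 1 / m * (2 * (1 / m)) := by
        apply mul_le_mul h5 (by linarith) _ (by positivity)
        rw [sub_nonneg, div_le_one hq]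
        exact Real.one_le_rpow (by linarith) (by linarith)
    _ = _ := by field_simp

lemma summable_bound : Summable (fun n : ℕ => 2 * (1 / ((n : ℝ) + 1) ^ 2)) := by
  have := (summable_nat_add_iff 1).2 (Real.summable_one_div_nat_pow.2 (one_lt_two))
  apply Summable.mul_left
  simpa using this

lemma hurwitz_diff {x : ℝ} (hx0 : 0 < x) (hx1 : x < 1) :
    hurwitzZeta (x : UnitAddCircle) 1 - riemannZeta 1 = (psiE x : ℂ) := by
  have hc := (differentiable_hurwitzZeta_sub_hurwitzZeta (x : UnitAddCircle) 0).continuous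
  have hof : Tendsto (fun s : ℝ => (s : ℂ)) (𝓝[>] 1) (𝓝 1) := by
    simpa using (Complex.continuous_ofReal.tendsto 1).mono_left nhdsWithin_le_nhds
  have h1 : Tendsto (fun s : ℝ => hurwitzZeta (x : UnitAddCircle) s - hurwitzZeta 0 s) (𝓝[>] 1)
      (𝓝 (hurwitzZeta (x : UnitAddCircle) 1 - hurwitzZeta 0 1)) :=
    (hc.tendsto 1).comp hof
  have h2 : Tendsto (fun s : ℝ => 1 / x ^ s +
      ∑' n : ℕ, (1 / (n + 1 + x) ^ s - 1 / ((n : ℝ) + 1) ^ s)) (𝓝[>] 1) (𝓝 (psiE x)) := by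
    unfold psiE
    have key : ∀ y : ℝ, 0 < y → Tendsto (fun s : ℝ => 1 / y ^ s) (𝓝[>] 1) (𝓝 (1 / y)) := by
      intro y hy
      have : ContinuousAt (fun s : ℝ => 1 / y ^ s) 1 := by
        apply ContinuousAt.div continuousAt_const (Real.continuousAt_const_rpow hy.ne')
        positivity
      simpa using this.tendsto.mono_left nhdsWithin_le_nhds
    apply (key x hx0).add
    apply tendsto_tsum_of_dominated_convergence summable_bound
    · intro n
      exact (key _ (by positivity)).sub (key _ (by positivity))
    · have : ∀ᶠ s : ℝ in 𝓝[>] 1, s ≤ 2 := by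
        apply eventually_nhdsWithin_of_eventually_nhds
        exact eventually_le_nhds (by norm_num)
      filter_upwards [this, self_mem_nhdsWithin] with s hs hs1 n
      exact psiE_bound hx0 hx1 (le_of_lt hs1) hs n
  have h3 := (Complex.continuous_ofReal.tendsto _).comp h2
  have h4 : (fun s : ℝ => hurwitzZeta (x : UnitAddCircle) s - hurwitzZeta 0 s) =ᶠ[𝓝[>] 1]
      (Complex.ofReal ∘ fun s : ℝ => 1 / x ^ s +
      ∑' n : ℕ, (1 / (n + 1 + x) ^ s - 1 / ((n : ℝ) + 1) ^ s)) := by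
    filter_upwards [self_mem_nhdsWithin] with s hs
    have hs' : 1 < (s : ℂ).re := by simpa using hs
    have e1 := hasSum_hurwitzZeta_of_one_lt_re (a := x) ⟨hx0.le, hx1.le⟩ hs'
    have e2 := hasSum_hurwitzZeta_of_one_lt_re (a := 1) ⟨zero_le_one, le_rfl⟩ hs'
    have e3 := (hasSum_nat_add_iff' 1).2 e1
    have e4 := e3.sub e2
    have hz : ((1 : ℝ) : UnitAddCircle) = 0 := by
      simp
    rw [hz] at e4
    have e5 := e4.tsum_eq
    simp only [Finset.range_one, Finset.sum_singleton, Nat.cast_zero, zero_add] at e5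
    have e6 : ((1 / x ^ s : ℝ) : ℂ) = 1 / (x : ℂ) ^ (s : ℂ) := by
      rw [← Complex.ofReal_cpow hx0.le]; push_cast; rfl
    simp only [Function.comp]
    rw [Complex.ofReal_add, Complex.ofReal_tsum, e6]
    have e7 : ∀ n : ℕ, ((1 / (n + 1 + x) ^ s - 1 / ((n : ℝ) + 1) ^ s : ℝ) : ℂ) =
       1 / (((n + 1 : ℕ) : ℂ) + (x : ℂ)) ^ (s : ℂ) - 1 / ((n : ℂ) + (1 : ℝ)) ^ (s : ℂ) := by
      intro n
      rw [Complex.ofReal_sub, Complex.ofReal_div, Complex.ofReal_div,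
        Complex.ofReal_cpow (by positivity), Complex.ofReal_cpow (by positivity)]
      push_cast; rfl
    rw [tsum_congr e7, e5]
    ring
  have := tendsto_nhds_unique (h1.congr' h4) h3
  rw [← this, hurwitzZeta_zero]

lemma series_eq {x : ℝ} (hx0 : 0 < x) (hx1 : x < 1) :
    1 / (x : ℂ) + ∑' n : ℕ, aSeq n * (x : ℂ) ^ n = Real.eulerMascheroniConstant + (psiE x : ℂ) := by
  let f : ℕ × ℕ → ℂ := fun p => (-1) ^ (p.1 + 1) * (1 / ((p.2 : ℂ) + 1) ^ (p.1 + 2)) * (x : ℂ) ^ (p.1 + 1)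
  have hf : Summable f := by
    have hg : Summable (fun k : ℕ => x ^ (k + 1)) :=
      (summable_nat_add_iff 1).2 (summable_geometric_of_lt_one hx0.le hx1)
    have := hg.mul_of_nonneg summable_bound (fun _ => by positivity) (fun _ => by positivity)
    apply Summable.of_norm_bounded this
    rintro ⟨k, n⟩
    have hb : ‖(n : ℂ) + 1‖ = (n : ℝ) + 1 := by
      have := Complex.norm_natCast (n + 1)
      simpa using this
    simp only [f, norm_mul, norm_pow, norm_neg, norm_one, one_pow, one_mul, norm_div, hb,
      Complex.norm_real, Real.norm_eq_abs, abs_of_pos hx0]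
    rw [mul_comm]
    apply mul_le_mul_of_nonneg_left _ (by positivity)
    have h1 : (1 : ℝ) ≤ n + 1 := by simp
    calc 1 / ((n : ℝ) + 1) ^ (k + 2) ≤ 1 / ((n : ℝ) + 1) ^ 2 := by
          apply one_div_le_one_div_of_le (by positivity)
          exact pow_le_pow_right₀ h1 (by omega)
      _ ≤ _ := by
          have : 0 ≤ 1 / ((n : ℝ) + 1) ^ 2 := by positivity
          linarith
  have hinner : ∀ k : ℕ, ∑' n : ℕ, f (k, n) = aSeq (k + 1) * (x : ℂ) ^ (k + 1) := by
    intro k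
    simp only [f]
    rw [tsum_mul_right, tsum_mul_left, aSeq]
    congr 2
    rw [zeta_eq_tsum_one_div_nat_add_one_cpow (by simp; linarith [(k.cast_nonneg : (0 : ℝ) ≤ k)])]
    apply tsum_congr
    intro n
    rw [← Complex.cpow_natCast]
    push_cast; rfl
  have hS : Summable (fun k : ℕ => aSeq (k + 1) * (x : ℂ) ^ (k + 1)) := by
    simp_rw [← hinner]
    exact hf.prod
  have hS' : Summable (fun k : ℕ => aSeq k * (x : ℂ) ^ k) := (summable_nat_add_iff 1).1 hS
  rw [hS'.tsum_eq_zero_add]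
  simp_rw [← hinner]
  rw [Summable.tsum_comm' (f := fun n k => f (k, n)) hf.prod_symm hf.prod_symm.prod_factor hf.prod_factor]
  have houter : ∀ n : ℕ, ∑' k : ℕ, f (k, n) = ((1 / (n + 1 + x) - 1 / ((n : ℝ) + 1) : ℝ) : ℂ) := by
    intro n
    have hn : (0 : ℝ) < n + 1 := by positivity
    have hn' : (n : ℂ) + 1 ≠ 0 := by exact_mod_cast hn.ne'
    have hnx : (n : ℂ) + 1 + x ≠ 0 := by
      have : (n : ℝ) + 1 + x ≠ 0 := by positivity
      exact_mod_cast this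
    have hr : ‖-(x : ℂ) / (n + 1)‖ < 1 := by
      have hb : ‖(n : ℂ) + 1‖ = (n : ℝ) + 1 := by
        have := Complex.norm_natCast (n + 1)
        simpa using this
      rw [norm_div, norm_neg, hb, Complex.norm_real, Real.norm_eq_abs, abs_of_pos hx0,
        div_lt_one hn]
      linarith [(n.cast_nonneg : (0 : ℝ) ≤ n)]
    have he : ∀ k : ℕ, f (k, n) = (-(x : ℂ) / (n + 1)) ^ k * (-(x : ℂ) / (n + 1) ^ 2) := by
      intro k
      simp only [f]
      rw [div_pow, neg_pow (x : ℂ) k]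
      field_simp
      ring
    rw [tsum_congr he, tsum_mul_right, tsum_geometric_of_norm_lt_one hr]
    push_cast
    have : 1 - -(x : ℂ) / (n + 1) = (n + 1 + x) / (n + 1) := by field_simp; ring
    rw [this]
    field_simp
    ring
  rw [tsum_congr houter, ← Complex.ofReal_tsum]
  simp only [psiE, aSeq]
  push_cast
  ring


lemma deriv_aux (q : ℕ) (hq : q ≠ 0) :
    HasDerivAt (fun s : ℂ => (∏ p ∈ q.primeFactors, (1 - (p : ℂ) ^ (-s))) - q.totient * (q : ℂ) ^ (-s))
      ((q.totient : ℂ) / q * (Real.log q + ∑ p ∈ q.primeFactors, Real.log p / (p - 1))) 1 := by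
  have hcp : ∀ n : ℕ, n ≠ 0 → HasDerivAt (fun s : ℂ => (n : ℂ) ^ (-s)) (-(Real.log n / n : ℂ)) 1 := by
    intro n hn
    have hn' : (n : ℂ) ≠ 0 := by exact_mod_cast hn
    have := (hasDerivAt_neg (1 : ℂ)).const_cpow (c := (n : ℂ)) (Or.inl hn')
    convert this using 1
    rw [Complex.cpow_neg_one, Complex.natCast_log]
    field_simp
  have hprod := HasDerivAt.fun_finsetProd (u := q.primeFactors) (x := (1 : ℂ))
    (f := fun p s => (1 - (p : ℂ) ^ (-s))) (f' := fun p => (Real.log p / p : ℂ)) (by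
      intro p hp
      simpa using (hcp p (Nat.prime_of_mem_primeFactors hp).ne_zero).const_sub 1)
  have h := hprod.fun_sub ((hcp q hq).const_mul (q.totient : ℂ))
  refine h.congr_deriv ?_
  symm
  push_cast
  have hq' : (q : ℂ) ≠ 0 := by exact_mod_cast hq
  have ht : (q.totient : ℂ) / q = ∏ p ∈ q.primeFactors, (1 - (p : ℂ)⁻¹) := by
    have := congrArg (fun r : ℚ => (r : ℂ)) (Nat.totient_eq_mul_prod_factors q)
    push_cast at this
    rw [this]; field_simp
  rw [mul_add, Finset.mul_sum, add_comm]
  simp only [mul_neg, sub_neg_eq_add]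
  congr 1
  · apply Finset.sum_congr rfl
    intro p hp
    have hpp := Nat.prime_of_mem_primeFactors hp
    rw [ht, ← Finset.mul_prod_erase _ _ hp]
    have h0 : (p : ℂ) ≠ 0 := by exact_mod_cast hpp.ne_zero
    have h1 : (p : ℂ) - 1 ≠ 0 := sub_ne_zero.2 (by exact_mod_cast hpp.ne_one)
    simp only [Complex.cpow_neg_one, smul_eq_mul]
    field_simp
  · field_simp

lemma trivial_sum (q : ℕ) [NeZero q] :
    (1 / (q : ℂ)) * ∑ j : ZMod q, (1 : DirichletCharacter ℂ q) j *
      (hurwitzZeta (ZMod.toAddCircle j) 1 - riemannZeta 1)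
      = (q.totient : ℂ) / q * (Real.log q + ∑ p ∈ q.primeFactors, Real.log p / (p - 1)) := by
  have hq0 : (q : ℂ) ≠ 0 := by exact_mod_cast NeZero.ne q
  have hd := deriv_aux q (NeZero.ne q)
  have ht : (q.totient : ℂ) / q = ∏ p ∈ q.primeFactors, (1 - (p : ℂ)⁻¹) := by
    have := congrArg (fun r : ℚ => (r : ℂ)) (Nat.totient_eq_mul_prod_factors q)
    push_cast at this
    rw [this]; field_simp
  have hcard : ∑ j : ZMod q, (1 : DirichletCharacter ℂ q) j = q.totient := by
    rw [MulChar.sum_one_eq_card_units, ZMod.card_units_eq_totient]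
  have h1 := (hasDerivAt_iff_tendsto_slope.1 hd).mul riemannZeta_residue_one
  rw [mul_one] at h1
  have hcont : Continuous (fun s : ℂ => (q : ℂ) ^ (-s) * ∑ j : ZMod q, (1 : DirichletCharacter ℂ q) j *
      (hurwitzZeta (ZMod.toAddCircle j) s - hurwitzZeta 0 s)) := by
    apply Continuous.mul
    · fun_prop
    · refine continuous_finsetSum _ fun j _ => ?_
      exact continuous_const.mul (differentiable_hurwitzZeta_sub_hurwitzZeta _ 0).continuous
  have h2 := (hcont.tendsto 1).mono_left (nhdsWithin_le_nhds (s := {1}ᶜ))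
  have he : (fun s : ℂ => (q : ℂ) ^ (-s) * ∑ j : ZMod q, (1 : DirichletCharacter ℂ q) j *
      (hurwitzZeta (ZMod.toAddCircle j) s - hurwitzZeta 0 s)) =ᶠ[𝓝[≠] 1]
      fun s => slope (fun s : ℂ => (∏ p ∈ q.primeFactors, (1 - (p : ℂ) ^ (-s))) - q.totient * (q : ℂ) ^ (-s)) 1 s * ((s - 1) * riemannZeta s) := by
    filter_upwards [self_mem_nhdsWithin] with s hs
    have hs : s ≠ 1 := hs
    have hs' : s - 1 ≠ 0 := sub_ne_zero.2 hs
    have hL := DirichletCharacter.LFunctionTrivChar_eq_mul_riemannZeta (N := q) hs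
    have hLd : DirichletCharacter.LFunctionTrivChar q s = (q : ℂ) ^ (-s) * ∑ j : ZMod q,
      (1 : DirichletCharacter ℂ q) j * hurwitzZeta (ZMod.toAddCircle j) s := rfl
    simp only [slope_def_field, Complex.cpow_neg_one, ← ht]
    simp_rw [mul_sub, Finset.sum_sub_distrib, ← Finset.sum_mul]
    rw [hcard, mul_sub, ← hLd, hL, hurwitzZeta_zero]
    field_simp
    ring
  have := tendsto_nhds_unique (h2.congr' he) h1
  rw [← this, Complex.cpow_neg_one, hurwitzZeta_zero, one_div]

lemma parseval (q : ℕ) [NeZero q] (B : ZMod q → ℝ) :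
    ∑ χ : DirichletCharacter ℂ q, (‖∑ j : ZMod q, χ j * (B j : ℂ)‖ ^ 2 : ℂ) =
      q.totient * ∑ j : ZMod q with IsUnit j, (B j : ℂ) ^ 2 := by
  have h1 : ∀ χ : DirichletCharacter ℂ q, (‖∑ j : ZMod q, χ j * (B j : ℂ)‖ ^ 2 : ℂ) =
      ∑ a : ZMod q with IsUnit a, ∑ b : ZMod q, (B a * B b : ℂ) * (χ a⁻¹ * χ b) := by
    intro χ
    rw [← Complex.conj_mul', map_sum, Finset.sum_mul, Finset.sum_filter]
    apply Finset.sum_congr rfl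
    intro a _
    have : (starRingEnd ℂ) (χ a) = if IsUnit a then χ a⁻¹ else 0 := by
      have := MulChar.star_apply' χ a
      rw [starRingEnd_apply, this]
      split_ifs with ha
      · obtain ⟨u, rfl⟩ := ha
        rw [MulChar.inv_apply]
        congr 1
        rw [Ring.inverse_unit, ZMod.inv_coe_unit]
      · exact MulChar.map_nonunit _ ha
    rw [map_mul, this, Complex.conj_ofReal, Finset.mul_sum]
    split_ifs with ha
    · apply Finset.sum_congr rfl
      intros; ring
    · simp
  simp_rw [h1]
  rw [Finset.sum_comm, Finset.mul_sum]
  apply Finset.sum_congr rfl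
  intro a ha
  rw [Finset.sum_comm]
  simp_rw [← Finset.mul_sum, DirichletCharacter.sum_char_inv_mul_char_eq ℂ (Finset.mem_filter.1 ha).2]
  simp
  ring

lemma reindex (q : ℕ) [NeZero q] (hq : 3 ≤ q) (F : ℕ → ℂ) :
    ∑ a ∈ (Finset.Icc 1 q).filter (fun a => Nat.Coprime a q), F a =
      ∑ j : ZMod q with IsUnit j, F j.val := by
  have hlt : ∀ a ∈ (Finset.Icc 1 q).filter (fun a => Nat.Coprime a q), a < q := by
    intro a ha
    simp only [Finset.mem_filter, Finset.mem_Icc] at ha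
    rcases lt_or_eq_of_le ha.1.2 with h | h
    · exact h
    · rw [h, Nat.coprime_self] at ha; omega
  refine Finset.sum_nbij' (fun a => (a : ZMod q)) (fun j => j.val) ?_ ?_ ?_ ?_ ?_
  · intro a ha
    simp only [Finset.mem_filter, Finset.mem_univ, true_and]
    exact (ZMod.isUnit_iff_coprime a q).2 (Finset.mem_filter.1 ha).2
  · intro j hj
    have hj := (Finset.mem_filter.1 hj).2
    rw [← ZMod.natCast_zmod_val j, ZMod.isUnit_iff_coprime] at hj
    simp only [Finset.mem_filter, Finset.mem_Icc]
    refine ⟨⟨?_, (ZMod.val_lt j).le⟩, hj⟩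
    by_contra h
    have : j.val = 0 := by omega
    rw [this, Nat.coprime_zero_left] at hj
    omega
  · intro a ha
    exact ZMod.val_cast_of_lt (hlt a ha)
  · intro j _
    exact ZMod.natCast_zmod_val j
  · intro a ha
    rw [ZMod.val_cast_of_lt (hlt a ha)]

/-- For `q ≥ 3`:
`∑_{χ ≠ χ₀ (q)} |L(1,χ)|² = φ(q) ∑_{(a,q)=1,a≤q} (1/a + (1/q)∑_{n≥0} a_n (a/q)ⁿ)²
  − (φ(q)²/q²)(log q + ∑_{p|q} log p/(p−1) + γ)²`. -/
theorem sum_abs_LFunction_one_sq_eq {q : ℕ} (hq : 3 ≤ q) :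
    haveI : NeZero q := ⟨by omega⟩
    (∑ χ ∈ Finset.univ.filter (fun χ : DirichletCharacter ℂ q => χ ≠ 1),
        (‖χ.LFunction 1‖ ^ 2 : ℂ)) =
      (q.totient : ℂ) *
        ∑ a ∈ (Finset.Icc 1 q).filter (fun a => Nat.Coprime a q),
          (1 / (a : ℂ) + (1 / (q : ℂ)) * ∑' n : ℕ, aSeq n * ((a : ℂ) / q) ^ n) ^ 2 -
      (((q.totient : ℝ) ^ 2 / (q : ℝ) ^ 2 *
        (Real.log q + (∑ p ∈ q.primeFactors, Real.log p / (p - 1)) +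
          Real.eulerMascheroniConstant) ^ 2 : ℝ) : ℂ) := by
  have : NeZero q := ⟨by omega⟩
  have hq0 : (q : ℂ) ≠ 0 := by exact_mod_cast NeZero.ne q
  have hqpos : (0 : ℝ) < q := by exact_mod_cast (by omega : 0 < q)
  let B : ZMod q → ℝ := fun j => (Real.eulerMascheroniConstant + psiE ((j.val : ℝ) / q)) / q
  have hval : ∀ j : ZMod q, IsUnit j → 0 < (j.val : ℝ) / q ∧ (j.val : ℝ) / q < 1 := by
    intro j hj
    constructor
    · rw [← ZMod.natCast_zmod_val j, ZMod.isUnit_iff_coprime] at hj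
      have : j.val ≠ 0 := by
        intro h
        rw [h, Nat.coprime_zero_left] at hj
        omega
      have : (0 : ℝ) < j.val := by exact_mod_cast Nat.pos_of_ne_zero this
      positivity
    · rw [div_lt_one hqpos]
      exact_mod_cast ZMod.val_lt j
  have hB : ∀ j : ZMod q, IsUnit j → (B j : ℂ) = (1 / (q : ℂ)) *
      (Real.eulerMascheroniConstant + (hurwitzZeta (ZMod.toAddCircle j) 1 - riemannZeta 1)) := by
    intro j hj
    rw [ZMod.toAddCircle_apply, hurwitz_diff (hval j hj).1 (hval j hj).2]
    simp only [B]
    push_cast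
    ring
  have hchi : ∀ χ : DirichletCharacter ℂ q, ∑ j : ZMod q, χ j * (B j : ℂ) =
      (1 / (q : ℂ)) * ∑ j : ZMod q, χ j *
        (Real.eulerMascheroniConstant + (hurwitzZeta (ZMod.toAddCircle j) 1 - riemannZeta 1)) := by
    intro χ
    rw [Finset.mul_sum]
    apply Finset.sum_congr rfl
    intro j _
    by_cases hj : IsUnit j
    · rw [hB j hj]; ring
    · rw [MulChar.map_nonunit χ hj]; ring
  have hL : ∀ χ : DirichletCharacter ℂ q, χ ≠ 1 →
      χ.LFunction 1 = ∑ j : ZMod q, χ j * (B j : ℂ) := by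
    intro χ hχ
    rw [hchi]
    have hLd : χ.LFunction 1 = (q : ℂ) ^ (-(1 : ℂ)) * ∑ j : ZMod q,
      χ j * hurwitzZeta (ZMod.toAddCircle j) 1 := rfl
    rw [hLd, Complex.cpow_neg_one, one_div]
    congr 1
    simp_rw [mul_add, mul_sub, Finset.sum_add_distrib, Finset.sum_sub_distrib, ← Finset.sum_mul,
      MulChar.sum_eq_zero_of_ne_one hχ]
    ring
  have hone : ∑ j : ZMod q, (1 : DirichletCharacter ℂ q) j * (B j : ℂ) =
      (((q.totient : ℝ) / q * (Real.log q + (∑ p ∈ q.primeFactors, Real.log p / (p - 1)) +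
          Real.eulerMascheroniConstant) : ℝ) : ℂ) := by
    have hcard : ∑ j : ZMod q, (1 : DirichletCharacter ℂ q) j = q.totient := by
      rw [MulChar.sum_one_eq_card_units, ZMod.card_units_eq_totient]
    rw [hchi]
    simp_rw [mul_add]
    rw [Finset.sum_add_distrib, ← Finset.sum_mul, hcard, mul_add, trivial_sum]
    push_cast
    ring
  have hterm : ∀ a ∈ (Finset.univ.filter (fun χ : DirichletCharacter ℂ q => χ ≠ 1)),
      (‖a.LFunction 1‖ ^ 2 : ℂ) = (‖∑ j : ZMod q, a j * (B j : ℂ)‖ ^ 2 : ℂ) := by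
    intro χ hχ
    rw [hL χ (Finset.mem_filter.1 hχ).2]
  rw [Finset.sum_congr rfl hterm, Finset.filter_ne', Finset.sum_erase_eq_sub (Finset.mem_univ _),
    parseval, hone, reindex q hq]
  congr 1
  · congr 1
    apply Finset.sum_congr rfl
    intro j hj
    have hj := hval j (Finset.mem_filter.1 hj).2
    have hs := series_eq hj.1 hj.2
    have hv : (j.val : ℂ) ≠ 0 := by
      intro h
      have h' : (j.val : ℝ) = 0 := by exact_mod_cast h
      rw [h'] at hj
      simp at hj
    congr 1
    simp only [B]
    push_cast at hs ⊢
    rw [← hs]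
    field_simp
  · rw [Complex.norm_real, ← Complex.ofReal_pow, Real.norm_eq_abs, sq_abs]
    congr 1
    ring
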